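/- Suppose t = t(n) and b = b(n) are functions of n satisfying t/n → ∞, b → ∞, and 2b ≤ n³/t². Then, with probability tending to 1 as n → ∞, every subgraph of the uniformly random graph G_t on [n] with t edges that has at most b edges is 6-degenerate. -/

import Mathlib

open Filter

attribute [local instance] Classical.propDecidable

/-- The edges of the complete graph on `Fin n`: non-diagonal unordered pairs. -/
abbrev CEdge (n : ℕ) : Type := {e : Sym2 (Fin n) // ¬ e.IsDiag}

/-- The sample space: a uniformly random ordering of the edges of `K_n`,
encoded as a bijection from positions to edges. -/
abbrev EdgeOrdering (n : ℕ) : Type := Fin (Fintype.card (CEdge n)) ≃ CEdge n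

/-- The uniform probability of an event on a finite sample space. -/
noncomputable def uprob {α : Type} [Fintype α] (P : α → Prop) : ℝ :=
  ((Finset.univ.filter P).card : ℝ) / (Fintype.card α : ℝ)

/-- The sample space of the uniformly random graph with exactly `m` edges on `Fin n`. -/
abbrev MGraph (n m : ℕ) : Type := {P : Finset (CEdge n) // P.card = m}

/-- The graph given by the edge set `Q` is `z`-degenerate: every non-empty set `U` of
vertices contains a vertex with at most `z` neighbours inside `U` (in `Q`). -/
def DegenerateEdges (n z : ℕ) (Q : Finset (CEdge n)) : Prop :=
  ∀ U : Finset (Fin n), U.Nonempty → ∃ v ∈ U,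
    (Q.filter (fun e => v ∈ (e : Sym2 (Fin n)) ∧
      ∀ w ∈ (e : Sym2 (Fin n)), w ∈ U)).card ≤ z

/-- The edges of the complete graph with both endpoints in `U`. -/
noncomputable def insideEdges {n : ℕ} (U : Finset (Fin n)) : Finset (CEdge n) :=
  Finset.univ.filter (fun e => ∀ w ∈ (e : Sym2 (Fin n)), w ∈ U)

lemma card_insideEdges_le {n : ℕ} (U : Finset (Fin n)) :
    (insideEdges U).card ≤ U.card ^ 2 := by
  have h1 : (insideEdges U).card ≤ U.sym2.card := by
    refine Finset.card_le_card_of_injOn (fun e => (e : Sym2 (Fin n))) ?_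
      (Subtype.val_injective.injOn)
    intro e he
    have he' : ∀ w ∈ (e : Sym2 (Fin n)), w ∈ U := by
      simpa [insideEdges] using he
    exact Finset.mem_coe.2 (Finset.mem_sym2_iff.2 he')
  have h2 : U.sym2.card ≤ U.card ^ 2 := by
    rw [Finset.card_sym2, Nat.choose_two_right]
    apply Nat.div_le_of_le_mul
    rw [Nat.add_sub_cancel]
    rcases Nat.eq_zero_or_pos U.card with h | h <;> nlinarith
  exact h1.trans h2

/-- A set of edges that is not `6`-degenerate has at least `3|U|` edges inside some non-empty
vertex set `U`. -/
lemma exists_dense_of_not_degenerate {n : ℕ} {Q : Finset (CEdge n)}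
    (h : ¬ DegenerateEdges n 6 Q) :
    ∃ U : Finset (Fin n), U.Nonempty ∧ 3 * U.card ≤ (Q ∩ insideEdges U).card := by
  unfold DegenerateEdges at h
  push Not at h
  obtain ⟨U, hU, hdeg⟩ := h
  refine ⟨U, hU, ?_⟩
  have key := Finset.card_mul_le_card_mul (s := U) (t := Q ∩ insideEdges U)
    (fun (v : Fin n) (e : CEdge n) => v ∈ (e : Sym2 (Fin n))) (m := 7) (n := 2) ?_ ?_
  · omega
  · intro v hv
    refine (Nat.succ_le_of_lt (hdeg v hv)).trans ((Finset.card_le_card ?_).trans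
      (Finset.card_image_le (f := fun e : CEdge n => (e : Sym2 (Fin n)))))
    intro e he
    simp only [Finset.bind_def, Finset.pure_def, Finset.mem_filter, Finset.mem_sup,
      Finset.mem_singleton] at he
    obtain ⟨⟨a, haQ, rfl⟩, hv', hU'⟩ := he
    refine Finset.mem_image_of_mem _ ?_
    simp only [Finset.bipartiteAbove, insideEdges, Finset.mem_filter, Finset.mem_inter,
      Finset.mem_univ, true_and]
    exact ⟨⟨haQ, hU'⟩, hv'⟩
  · rintro ⟨e, hne⟩ -
    induction e using Sym2.ind with
    | _ x y =>
      refine (Finset.card_le_card (t := {x, y}) ?_).trans Finset.card_le_two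
      intro v hv
      simpa [Finset.bipartiteBelow] using (Finset.mem_filter.1 hv).2

lemma descFactorial_mul_pow_le {t N : ℕ} (h : t ≤ N) (m : ℕ) :
    t.descFactorial m * N ^ m ≤ N.descFactorial m * t ^ m := by
  induction m with
  | zero => simp
  | succ k ih =>
    have h1 : (t - k) * N ≤ (N - k) * t := by
      rw [Nat.sub_mul, Nat.sub_mul, Nat.mul_comm t N]
      exact Nat.sub_le_sub_left (Nat.mul_le_mul_left k h) _
    calc t.descFactorial (k + 1) * N ^ (k + 1)
        = ((t - k) * N) * (t.descFactorial k * N ^ k) := by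
          rw [Nat.descFactorial_succ]; ring
      _ ≤ ((N - k) * t) * (N.descFactorial k * t ^ k) := Nat.mul_le_mul h1 ih
      _ = N.descFactorial (k + 1) * t ^ (k + 1) := by
          rw [Nat.descFactorial_succ]; ring

lemma choose_sub_le {t N m : ℕ} (hN : 0 < N) (h : t ≤ N) (hm : m ≤ t) :
    ((N - m).choose (t - m) : ℝ) ≤ N.choose t * ((t : ℝ) / N) ^ m := by
  have h1 : t.choose m * N ^ m ≤ N.choose m * t ^ m := by
    have := descFactorial_mul_pow_le h m
    rw [Nat.descFactorial_eq_factorial_mul_choose, Nat.descFactorial_eq_factorial_mul_choose,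
      mul_assoc, mul_assoc] at this
    exact Nat.le_of_mul_le_mul_left this m.factorial_pos
  have h2 : N.choose t * t.choose m = N.choose m * (N - m).choose (t - m) :=
    Nat.choose_mul hm
  have h3 : 0 < N.choose m := Nat.choose_pos (hm.trans h)
  have h4 : (N - m).choose (t - m) * N ^ m ≤ N.choose t * t ^ m := by
    refine Nat.le_of_mul_le_mul_left ?_ h3
    calc N.choose m * ((N - m).choose (t - m) * N ^ m)
        = N.choose t * (t.choose m * N ^ m) := by rw [← mul_assoc, ← h2, mul_assoc]
      _ ≤ N.choose t * (N.choose m * t ^ m) := Nat.mul_le_mul_left _ h1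
      _ = _ := by ring
  have hN' : (0 : ℝ) < (N : ℝ) ^ m := by positivity
  rw [div_pow, ← mul_div_assoc, le_div_iff₀ hN']
  exact_mod_cast h4

lemma choose_le_three_mul_div_pow (N : ℕ) {m : ℕ} (hm : 0 < m) :
    (N.choose m : ℝ) ≤ (3 * N / m) ^ m := by
  have hm' : (0 : ℝ) < m := by exact_mod_cast hm
  have h2 : (m : ℝ) ^ m / m.factorial ≤ 3 ^ m := by
    refine (Real.pow_div_factorial_le_exp (m : ℝ) hm'.le m).trans ?_
    rw [← mul_one (m : ℝ), Real.exp_nat_mul]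
    exact pow_le_pow_left₀ (Real.exp_pos _).le (by linarith [Real.exp_one_lt_d9]) _
  calc (N.choose m : ℝ) ≤ (N : ℝ) ^ m / m.factorial := Nat.choose_le_pow_div m N
    _ = (N : ℝ) ^ m / m ^ m * ((m : ℝ) ^ m / m.factorial) := by field_simp
    _ ≤ (N : ℝ) ^ m / m ^ m * 3 ^ m := by gcongr
    _ = _ := by rw [div_pow, mul_pow]; ring

/-- The number of graphs with `t` edges that contain a given edge set. -/
lemma card_superset_le {n t : ℕ} (hN : 0 < Fintype.card (CEdge n))
    (h : t ≤ Fintype.card (CEdge n)) (S : Finset (CEdge n)) :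
    ((Finset.univ.filter (fun G : MGraph n t => S ⊆ G.1)).card : ℝ) ≤
      (Fintype.card (CEdge n)).choose t * ((t : ℝ) / Fintype.card (CEdge n)) ^ S.card := by
  by_cases hS : S.card ≤ t
  · refine le_trans ?_ (choose_sub_le hN h hS)
    rw [← Finset.card_compl, ← Finset.card_powersetCard]
    norm_cast
    refine Finset.card_le_card_of_injOn (fun G => G.1 \ S) ?_ ?_
    · intro G hG
      have hG' : S ⊆ G.1 := (Finset.mem_filter.1 hG).2
      rw [Finset.mem_coe, Finset.mem_powersetCard, Finset.card_sdiff_of_subset hG', G.2]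
      refine ⟨fun x hx => ?_, rfl⟩
      simpa using (Finset.mem_sdiff.1 hx).2
    · intro G hG G' hG' hEq
      have h1 : S ⊆ G.1 := (Finset.mem_filter.1 hG).2
      have h2 : S ⊆ G'.1 := (Finset.mem_filter.1 hG').2
      apply Subtype.ext
      rw [← Finset.sdiff_union_of_subset h1, ← Finset.sdiff_union_of_subset h2]
      exact congrArg (· ∪ S) hEq
  · rw [Finset.filter_eq_empty_iff.2]
    · simp only [Finset.card_empty, Nat.cast_zero]; positivity
    · intro G _ hG
      exact hS (G.2 ▸ Finset.card_le_card hG)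

lemma sum_pow_succ_le {q : ℝ} (h0 : 0 ≤ q) (h1 : q ≤ 1 / 2) (k : ℕ) :
    ∑ i ∈ Finset.range k, q ^ (i + 1) ≤ 2 * q := by
  have h : ∑ i ∈ Finset.range k, q ^ (i + 1) ≤ 2 * q - 2 * q * q ^ k := by
    induction k with
    | zero => simp
    | succ k ih =>
      rw [Finset.sum_range_succ]
      have hk : 0 ≤ q ^ (k + 1) * (1 / 2 - q) :=
        mul_nonneg (pow_nonneg h0 _) (by linarith)
      have : q ^ (k + 1) = q * q ^ k := pow_succ' q k
      nlinarith
  have : 0 ≤ 2 * q * q ^ k := by positivity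
  linarith

/-- The expected number of dense configurations on `u` vertices is at most `(6n/t)^u`. -/
lemma expected_dense_le {n t u N : ℕ} (hn : 0 < n) (ht : 0 < t) (hu : 0 < u)
    (hN : (n : ℝ) ^ 2 / 4 ≤ N) (hut : 6 * ((u : ℝ) * (t : ℝ) ^ 2) ≤ (n : ℝ) ^ 3) :
    (n.choose u : ℝ) * ((u ^ 2).choose (3 * u) : ℝ) * ((t : ℝ) / N) ^ (3 * u) ≤
      (6 * ((n : ℝ) / t)) ^ u := by
  have hn' : (0 : ℝ) < n := by exact_mod_cast hn
  have ht' : (0 : ℝ) < t := by exact_mod_cast ht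
  have hu' : (0 : ℝ) < u := by exact_mod_cast hu
  have h1 : (n.choose u : ℝ) ≤ (3 * n / u) ^ u := choose_le_three_mul_div_pow n hu
  have h2 : ((u ^ 2).choose (3 * u) : ℝ) ≤ (u : ℝ) ^ (3 * u) := by
    refine (choose_le_three_mul_div_pow (u ^ 2) (by omega : 0 < 3 * u)).trans_eq ?_
    congr 1
    push_cast
    field_simp
  have h3 : (t : ℝ) / N ≤ 4 * t / n ^ 2 := by
    calc (t : ℝ) / N ≤ t / ((n : ℝ) ^ 2 / 4) := by gcongr
      _ = _ := by field_simp
  calc (n.choose u : ℝ) * ((u ^ 2).choose (3 * u) : ℝ) * ((t : ℝ) / N) ^ (3 * u)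
      ≤ (3 * n / u) ^ u * (u : ℝ) ^ (3 * u) * (4 * t / n ^ 2) ^ (3 * u) := by gcongr
    _ = (3 * n / u * (u : ℝ) ^ 3 * (4 * t / n ^ 2) ^ 3) ^ u := by
        rw [pow_mul, pow_mul, mul_pow, mul_pow]
    _ ≤ (6 * ((n : ℝ) / t)) ^ u := by
        refine pow_le_pow_left₀ (by positivity) ?_ u
        have h4 : 36 * ((u : ℝ) * t ^ 2) ^ 2 ≤ (n : ℝ) ^ 6 := by
          have := pow_le_pow_left₀ (by positivity) hut 2
          nlinarith
        have h5 : 3 * n / u * (u : ℝ) ^ 3 * (4 * t / n ^ 2) ^ 3 =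
            192 * ((u : ℝ) * t ^ 2) ^ 2 / (n ^ 5 * t) := by field_simp; ring
        rw [h5, ← mul_div_assoc, div_le_div_iff₀ (by positivity) ht']
        nlinarith

/-- First moment bound for the number of graphs with a subgraph that has at most `b` edges and is
not `6`-degenerate. -/
lemma card_not_degenerate_le {n t b : ℕ} (hn : 0 < n) (ht : 0 < t)
    (hN : (n : ℝ) ^ 2 / 4 ≤ (Fintype.card (CEdge n) : ℝ))
    (htN : t ≤ Fintype.card (CEdge n))
    (hbt : 2 * (b : ℝ) * (t : ℝ) ^ 2 ≤ (n : ℝ) ^ 3) (hq : 6 * ((n : ℝ) / t) ≤ 1 / 2) :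
    ((Finset.univ.filter (fun G : MGraph n t =>
      ¬ ∀ Q : Finset (CEdge n), Q ⊆ G.1 → Q.card ≤ b → DegenerateEdges n 6 Q)).card : ℝ) ≤
      (Fintype.card (CEdge n)).choose t * (12 * ((n : ℝ) / t)) := by
  set N := Fintype.card (CEdge n) with hNdef
  have hNpos : 0 < N := ht.trans_le htN
  have hsub : (Finset.univ.filter (fun G : MGraph n t =>
      ¬ ∀ Q : Finset (CEdge n), Q ⊆ G.1 → Q.card ≤ b → DegenerateEdges n 6 Q)) ⊆
      (Finset.range (b / 3)).biUnion fun k =>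
        (Finset.powersetCard (k + 1) (Finset.univ : Finset (Fin n))).biUnion fun U =>
          (Finset.powersetCard (3 * (k + 1)) (insideEdges U)).biUnion fun S =>
            Finset.univ.filter (fun G : MGraph n t => S ⊆ G.1) := by
    intro G hG
    have hG' := (Finset.mem_filter.1 hG).2
    push Not at hG'
    obtain ⟨Q, hQG, hQb, hQ⟩ := hG'
    obtain ⟨U, hU, hdense⟩ := exists_dense_of_not_degenerate hQ
    obtain ⟨S, hS, hScard⟩ := Finset.exists_subset_card_eq hdense
    have hle : (Q ∩ insideEdges U).card ≤ Q.card :=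
      Finset.card_le_card Finset.inter_subset_left
    have hUpos : 0 < U.card := hU.card_pos
    simp only [Finset.mem_biUnion, Finset.mem_range, Finset.mem_powersetCard,
      Finset.mem_filter, Finset.mem_univ, true_and]
    exact ⟨U.card - 1, by omega, U, ⟨Finset.subset_univ _, by omega⟩, S,
      ⟨hS.trans Finset.inter_subset_right, by omega⟩,
      (hS.trans Finset.inter_subset_left).trans hQG⟩
  have hU : ∀ k, ∀ U ∈ Finset.powersetCard (k + 1) (Finset.univ : Finset (Fin n)),
      (((Finset.powersetCard (3 * (k + 1)) (insideEdges U)).biUnion fun S =>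
        Finset.univ.filter (fun G : MGraph n t => S ⊆ G.1)).card : ℝ) ≤
      (((k + 1) ^ 2).choose (3 * (k + 1)) : ℝ) *
        (N.choose t * ((t : ℝ) / N) ^ (3 * (k + 1))) := by
    intro k U hU
    rw [Finset.mem_powersetCard] at hU
    calc _ ≤ ∑ S ∈ Finset.powersetCard (3 * (k + 1)) (insideEdges U),
          ((Finset.univ.filter (fun G : MGraph n t => S ⊆ G.1)).card : ℝ) := by
          exact_mod_cast Finset.card_biUnion_le
      _ ≤ ∑ S ∈ Finset.powersetCard (3 * (k + 1)) (insideEdges U),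
          ((N.choose t : ℝ) * ((t : ℝ) / N) ^ (3 * (k + 1))) := by
          refine Finset.sum_le_sum fun S hS => ?_
          rw [← (Finset.mem_powersetCard.1 hS).2]
          exact card_superset_le hNpos htN S
      _ ≤ _ := by
          rw [Finset.sum_const, nsmul_eq_mul, Finset.card_powersetCard]
          refine mul_le_mul_of_nonneg_right ?_ (by positivity)
          have := card_insideEdges_le U
          rw [hU.2] at this
          exact_mod_cast Nat.choose_le_choose _ this
  have hk : ∀ k ∈ Finset.range (b / 3),
      (((Finset.powersetCard (k + 1) (Finset.univ : Finset (Fin n))).biUnion fun U =>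
        (Finset.powersetCard (3 * (k + 1)) (insideEdges U)).biUnion fun S =>
          Finset.univ.filter (fun G : MGraph n t => S ⊆ G.1)).card : ℝ) ≤
      N.choose t * (6 * ((n : ℝ) / t)) ^ (k + 1) := by
    intro k hk
    have hkb : 3 * (k + 1) ≤ b := by
      rw [Finset.mem_range] at hk; omega
    have hkb' : 3 * ((k + 1 : ℕ) : ℝ) ≤ b := by exact_mod_cast hkb
    have hut : 6 * (((k + 1 : ℕ) : ℝ) * (t : ℝ) ^ 2) ≤ (n : ℝ) ^ 3 := by
      have := mul_le_mul_of_nonneg_right hkb' (sq_nonneg (t : ℝ))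
      linarith
    calc _ ≤ ∑ U ∈ Finset.powersetCard (k + 1) (Finset.univ : Finset (Fin n)),
          (((Finset.powersetCard (3 * (k + 1)) (insideEdges U)).biUnion fun S =>
            Finset.univ.filter (fun G : MGraph n t => S ⊆ G.1)).card : ℝ) := by
          exact_mod_cast Finset.card_biUnion_le
      _ ≤ _ := Finset.sum_le_sum (hU k)
      _ = N.choose t * ((n.choose (k + 1) : ℝ) * (((k + 1) ^ 2).choose (3 * (k + 1)) : ℝ) *
            ((t : ℝ) / N) ^ (3 * (k + 1))) := by
          rw [Finset.sum_const, nsmul_eq_mul, Finset.card_powersetCard, Finset.card_univ,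
            Fintype.card_fin]
          ring
      _ ≤ _ := mul_le_mul_of_nonneg_left
          (expected_dense_le hn ht k.succ_pos hN hut) (by positivity)
  calc _ ≤ (((Finset.range (b / 3)).biUnion fun k =>
        (Finset.powersetCard (k + 1) (Finset.univ : Finset (Fin n))).biUnion fun U =>
          (Finset.powersetCard (3 * (k + 1)) (insideEdges U)).biUnion fun S =>
            Finset.univ.filter (fun G : MGraph n t => S ⊆ G.1)).card : ℝ) := by
        exact_mod_cast Finset.card_le_card hsub
    _ ≤ ∑ k ∈ Finset.range (b / 3),
        (((Finset.powersetCard (k + 1) (Finset.univ : Finset (Fin n))).biUnion fun U =>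
          (Finset.powersetCard (3 * (k + 1)) (insideEdges U)).biUnion fun S =>
            Finset.univ.filter (fun G : MGraph n t => S ⊆ G.1)).card : ℝ) := by
        exact_mod_cast Finset.card_biUnion_le
    _ ≤ ∑ k ∈ Finset.range (b / 3), N.choose t * (6 * ((n : ℝ) / t)) ^ (k + 1) :=
        Finset.sum_le_sum hk
    _ ≤ N.choose t * (2 * (6 * ((n : ℝ) / t))) := by
        rw [← Finset.mul_sum]
        exact mul_le_mul_of_nonneg_left (sum_pow_succ_le (by positivity) hq _) (by positivity)
    _ = _ := by ring

lemma card_CEdge (n : ℕ) : Fintype.card (CEdge n) = n.choose 2 := by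
  have h := Sym2.card_subtype_not_diag (α := Fin n)
  rw [Fintype.card_fin] at h
  rw [← h]

lemma card_MGraph (n m : ℕ) : Fintype.card (MGraph n m) = (Fintype.card (CEdge n)).choose m := by
  rw [← Fintype.card_finset_len]

lemma uprob_le_one {α : Type} [Fintype α] (P : α → Prop) : uprob P ≤ 1 :=
  div_le_one_of_le₀ (by exact_mod_cast Finset.card_filter_le _ _) (by positivity)

lemma one_sub_le_uprob {α : Type} [Fintype α] (P : α → Prop) {ε : ℝ}
    (hα : 0 < Fintype.card α)
    (h : ((Finset.univ.filter (fun a => ¬ P a)).card : ℝ) ≤ Fintype.card α * ε) :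
    1 - ε ≤ uprob P := by
  have hα' : (0 : ℝ) < Fintype.card α := by exact_mod_cast hα
  have hsum : ((Finset.univ.filter P).card : ℝ) +
      ((Finset.univ.filter (fun a => ¬ P a)).card : ℝ) = Fintype.card α := by
    exact_mod_cast Finset.card_filter_add_card_filter_not (s := Finset.univ) P
  unfold uprob
  rw [le_div_iff₀ hα']
  linarith

/-- If `t ≫ n`, `b → ∞` and `2b ≤ n³/t²`, then with high probability every subgraph of the
uniformly random graph with `t` edges having at most `b` edges is `6`-degenerate. -/
theorem stmt18 (t b : ℕ → ℕ)
    (ht : Tendsto (fun n : ℕ => (t n : ℝ) / (n : ℝ)) atTop atTop)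
    (hb : Tendsto (fun n => b n) atTop atTop)
    (hbt : ∀ n : ℕ, 2 * (b n : ℝ) ≤ (n : ℝ) ^ 3 / (t n : ℝ) ^ 2) :
    Tendsto
      (fun n => uprob (fun G : MGraph n (t n) =>
        ∀ Q : Finset (CEdge n), Q ⊆ G.1 → Q.card ≤ b n → DegenerateEdges n 6 Q))
      atTop (nhds 1) := by
  have hlim : Tendsto (fun n : ℕ => 1 - 12 * ((n : ℝ) / (t n : ℝ))) atTop (nhds 1) := by
    have h := ht.inv_tendsto_atTop
    have h' := (h.const_mul 12).const_sub 1
    simpa [inv_div] using h'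
  refine tendsto_of_tendsto_of_tendsto_of_le_of_le' hlim tendsto_const_nhds ?_
    (Eventually.of_forall fun n => uprob_le_one _)
  filter_upwards [ht.eventually_ge_atTop 12, hb.eventually_ge_atTop 1, eventually_ge_atTop 2]
    with n htn hbn hn
  have hn' : (2 : ℝ) ≤ n := by exact_mod_cast hn
  have htn' : 12 * (n : ℝ) ≤ t n := by rwa [le_div_iff₀ (by linarith)] at htn
  have htpos' : (0 : ℝ) < t n := by linarith
  have htpos : 0 < t n := by exact_mod_cast htpos'
  have hbn' : (1 : ℝ) ≤ b n := by exact_mod_cast hbn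
  have hbt' : 2 * (b n : ℝ) * (t n : ℝ) ^ 2 ≤ (n : ℝ) ^ 3 :=
    (le_div_iff₀ (by positivity)).1 (hbt n)
  have hNeq : (Fintype.card (CEdge n) : ℝ) = n * (n - 1) / 2 := by
    rw [card_CEdge, Nat.cast_choose_two]
  have hN : (n : ℝ) ^ 2 / 4 ≤ (Fintype.card (CEdge n) : ℝ) := by
    rw [hNeq]; nlinarith
  have htN : t n ≤ Fintype.card (CEdge n) := by
    have h1 : (t n : ℝ) ^ 2 ≤ (n : ℝ) ^ 3 := by nlinarith [sq_nonneg (t n : ℝ)]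
    have h2 : (n : ℝ) * (12 * t n) ≤ n * n ^ 2 := by nlinarith
    have h3 : 12 * (t n : ℝ) ≤ n ^ 2 := le_of_mul_le_mul_left h2 (by linarith)
    have h4 : (t n : ℝ) ≤ (Fintype.card (CEdge n) : ℝ) := by linarith
    exact_mod_cast h4
  have hq : 6 * ((n : ℝ) / t n) ≤ 1 / 2 := by
    rw [← mul_div_assoc, div_le_iff₀ htpos']
    linarith
  refine one_sub_le_uprob _ ?_ ?_
  · rw [card_MGraph]
    exact Nat.choose_pos htN
  · rw [card_MGraph]
    convert card_not_degenerate_le (show 0 < n by omega) htpos hN htN hbt' hq
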